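/- There exists an absolute constant C₀ such that the following holds. Let a > 1/2, ε ∈ (0,1), and let N be an integer with log N ≥ C₀(1 + a). Define v_N(t,x) := √(2π/log N) · (2π)^{−2} ∫_{1<|ξ|<e^{−a}N} |ξ|^{−2} cos(−t√(1+|ξ|²) + ξ·x) dξ. Then for all (t,x) with 0 ≤ t ≤ ε/(2N) and |x| ≤ ε/(2N), one has v_N(t,x) ≥ √(log N/(2π)) − C₀(1 + a + ε²)/√(log N). -/

import Mathlib

open MeasureTheory Real Classical
open scoped ENNReal RealInnerProductSpace

noncomputable section

/-- The plane `ℝ²`. -/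
abbrev Plane := EuclideanSpace ℝ (Fin 2)

/-- Pointwise norm of the (full) gradient of `u`. -/
def gradNorm (u : Plane → ℝ) (x : Plane) : ℝ := ‖fderiv ℝ u x‖

/-- The `L^p` norm for a real (finite) exponent `p`. -/
def LpNorm (p : ℝ) (u : Plane → ℝ) : ℝ := (∫ x : Plane, |u x| ^ p) ^ (1 / p)

/-- The sup (`L^∞`) norm. -/
def supNorm (u : Plane → ℝ) : ℝ := ⨆ x : Plane, |u x|

/-- The homogeneous Hölder seminorm `[u]_α`. -/
def holderSemi (α : ℝ) (u : Plane → ℝ) : ℝ :=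
  ⨆ p : Plane × Plane,
    if p.1 = p.2 then 0 else |u p.1 - u p.2| / ‖p.1 - p.2‖ ^ α

/-- The Hölder norm `‖u‖_{C^α} = sup |u| + [u]_α`. -/
def holderNorm (α : ℝ) (u : Plane → ℝ) : ℝ := supNorm u + holderSemi α u

/-- `u` is `α`-Hölder continuous. -/
def IsHolder (α : ℝ) (u : Plane → ℝ) : Prop :=
  ∃ C : ℝ, 0 ≤ C ∧ ∀ x y : Plane, |u x - u y| ≤ C * ‖x - y‖ ^ α

/-- The squared `H¹` norm `‖∇u‖_{L²}² + ‖u‖_{L²}²`. -/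
def H1Sq (u : Plane → ℝ) : ℝ :=
  (∫ x : Plane, gradNorm u x ^ 2) + ∫ x : Plane, u x ^ 2

/-- The squared local `H¹` norm `‖u‖_{H¹[R]}²`. -/
def H1locSq (R : ℝ) (u : Plane → ℝ) : ℝ :=
  ⨆ c : Plane, ∫ x in Metric.closedBall c R, (gradNorm u x ^ 2 + u x ^ 2)

/-- Membership in `H¹(ℝ²)` (with classical derivatives). -/
def MemH1 (u : Plane → ℝ) : Prop :=
  Differentiable ℝ u ∧ Integrable (fun x => u x ^ 2) ∧
    Integrable (fun x => gradNorm u x ^ 2)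

/-- The nonlinearity `f(u) = (e^{4π u²} - 1 - 4π u²) u`. -/
def f (s : ℝ) : ℝ := (Real.exp (4 * π * s ^ 2) - 1 - 4 * π * s ^ 2) * s

/-- The potential `F(u) = (1/8π)(e^{4π u²} - 1 - 4π u² - 8π² u⁴)`. -/
def F (s : ℝ) : ℝ :=
  (8 * π)⁻¹ * (Real.exp (4 * π * s ^ 2) - 1 - 4 * π * s ^ 2 - 8 * π ^ 2 * s ^ 4)

/-- The frequency annulus `1 < |ξ| < e^{-a} N`. -/
def freqSet (a N : ℝ) : Set Plane := {ξ | 1 < ‖ξ‖ ∧ ‖ξ‖ < Real.exp (-a) * N}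

/-- The concentrating family of radial free Klein–Gordon solutions `v_N`. -/
def vKG (a : ℝ) (N : ℕ) (t : ℝ) (x : Plane) : ℝ :=
  Real.sqrt (2 * π / Real.log N) * (2 * π) ^ (-2 : ℤ) *
    ∫ ξ in freqSet a N, ‖ξ‖ ^ (-2 : ℤ) *
      Real.cos (-t * Real.sqrt (1 + ‖ξ‖ ^ 2) + ⟪ξ, x⟫)

/-- Integral of `‖ξ‖⁻² - K` over the annulus `1 < ‖ξ‖ < R` in the plane. -/
theorem setIntegral_annulus_norm_zpow_sub {R : ℝ} (hR : 1 < R) (K : ℝ) :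
    ∫ ξ in {ξ : Plane | 1 < ‖ξ‖ ∧ ‖ξ‖ < R}, (‖ξ‖ ^ (-2 : ℤ) - K) =
      2 * π * (Real.log R - K * (R ^ 2 - 1) / 2) := by
  have hmeas : MeasurableSet {ξ : Plane | 1 < ‖ξ‖ ∧ ‖ξ‖ < R} :=
    (measurableSet_lt measurable_const measurable_norm).inter
      (measurableSet_lt measurable_norm measurable_const)
  have hball : (volume : Measure Plane).real (Metric.ball 0 1) = π := by
    rw [Measure.real, EuclideanSpace.volume_ball_fin_two]
    simp [ENNReal.toReal_ofReal, pi_pos.le]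
  have hradial := integral_fun_norm_addHaar (volume : Measure Plane)
    ((Set.Ioo 1 R).indicator fun r : ℝ => r ^ (-2 : ℤ) - K)
  have hind : ∀ ξ : Plane, (Set.Ioo 1 R).indicator (fun r : ℝ => r ^ (-2 : ℤ) - K) ‖ξ‖ =
      {ξ : Plane | 1 < ‖ξ‖ ∧ ‖ξ‖ < R}.indicator (fun ξ => ‖ξ‖ ^ (-2 : ℤ) - K) ξ := by
    intro ξ
    simp only [Set.indicator, Set.mem_Ioo, Set.mem_ofPred_eq]
  simp only [hind] at hradial
  rw [integral_indicator hmeas, hball, finrank_euclideanSpace_fin] at hradial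
  rw [hradial]
  have hweight : ∀ y : ℝ, y ^ (2 - 1) •
      (Set.Ioo 1 R).indicator (fun r : ℝ => r ^ (-2 : ℤ) - K) y =
      (Set.Ioo 1 R).indicator (fun r : ℝ => r⁻¹ - K * r) y := by
    intro y
    by_cases hy : y ∈ Set.Ioo 1 R
    · have : y ≠ 0 := by linarith [hy.1]
      simp only [Set.indicator_of_mem hy, smul_eq_mul]
      rw [zpow_neg]
      norm_cast
      field_simp
      ring
    · simp [Set.indicator_of_notMem hy]
  simp only [hweight]
  have hsub : Set.Ioo 1 R ⊆ Set.Ioi 0 := fun y hy => Set.mem_Ioi.mpr (zero_lt_one.trans hy.1)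
  rw [setIntegral_indicator measurableSet_Ioo,
    Set.inter_eq_right.mpr hsub,
    ← integral_Ioc_eq_integral_Ioo, ← intervalIntegral.integral_of_le hR.le,
    intervalIntegral.integral_sub, intervalIntegral.integral_const_mul, integral_inv, integral_id]
  · simp only [div_one, nsmul_eq_mul, smul_eq_mul]
    push_cast
    ring
  · rw [Set.uIcc_of_le hR.le]
    exact fun h => by linarith [h.1]
  · refine intervalIntegrable_inv_iff.mpr (Or.inr ?_)
    rw [Set.uIcc_of_le hR.le]
    exact fun h => by linarith [h.1]
  · exact (continuous_const.mul continuous_id).intervalIntegrable _ _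

/-- A measurable function bounded on an annulus of the plane is integrable there. -/
theorem integrableOn_annulus_of_bounded (R C : ℝ) {g : Plane → ℝ} (hg : Measurable g)
    (hC : ∀ ξ : Plane, 1 < ‖ξ‖ → ‖ξ‖ < R → |g ξ| ≤ C) :
    IntegrableOn g {ξ : Plane | 1 < ‖ξ‖ ∧ ‖ξ‖ < R} := by
  have hmeas : MeasurableSet {ξ : Plane | 1 < ‖ξ‖ ∧ ‖ξ‖ < R} :=
    (measurableSet_lt measurable_const measurable_norm).inter
      (measurableSet_lt measurable_norm measurable_const)
  have hfin : volume {ξ : Plane | 1 < ‖ξ‖ ∧ ‖ξ‖ < R} < ⊤ :=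
    (measure_mono fun ξ hξ => by simpa using hξ.2).trans_lt
      (measure_ball_lt_top (x := (0 : Plane)) (r := R))
  refine IntegrableOn.of_bound hfin hg.aestronglyMeasurable C ?_
  filter_upwards [ae_restrict_mem hmeas] with ξ hξ
  exact hC ξ hξ.1 hξ.2

/-- Quadratic lower bound for the cosine of the Klein–Gordon phase near the space-time origin. -/
theorem one_sub_sq_le_cos_phase {δ t : ℝ} {x ξ : Plane} (ht : 0 ≤ t) (htδ : t ≤ δ)
    (hx : ‖x‖ ≤ δ) (hξ : 1 ≤ ‖ξ‖) :
    1 - 9 / 2 * δ ^ 2 * ‖ξ‖ ^ 2 ≤ Real.cos (-t * Real.sqrt (1 + ‖ξ‖ ^ 2) + ⟪ξ, x⟫) := by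
  have hδ : 0 ≤ δ := ht.trans htδ
  have hsqrt : Real.sqrt (1 + ‖ξ‖ ^ 2) ≤ 2 * ‖ξ‖ :=
    Real.sqrt_le_iff.mpr ⟨by positivity, by nlinarith⟩
  have htime : t * Real.sqrt (1 + ‖ξ‖ ^ 2) ≤ δ * (2 * ‖ξ‖) :=
    mul_le_mul htδ hsqrt (Real.sqrt_nonneg _) hδ
  have htime_nonneg : 0 ≤ t * Real.sqrt (1 + ‖ξ‖ ^ 2) := by positivity
  have hinner : |(⟪ξ, x⟫ : ℝ)| ≤ ‖ξ‖ * δ :=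
    (abs_real_inner_le_norm ξ x).trans (by gcongr)
  have hphase : |(-t * Real.sqrt (1 + ‖ξ‖ ^ 2) + ⟪ξ, x⟫ : ℝ)| ≤ 3 * δ * ‖ξ‖ := by
    rw [abs_le] at hinner ⊢
    constructor <;> nlinarith [hinner.1, hinner.2, mul_nonneg hδ (norm_nonneg ξ)]
  have hsq := sq_le_sq' (abs_le.mp hphase).1 (abs_le.mp hphase).2
  have hcos := Real.one_sub_sq_div_two_le_cos
    (x := -t * Real.sqrt (1 + ‖ξ‖ ^ 2) + ⟪ξ, x⟫)
  nlinarith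

/-- pointwise lower bound for `v_N` on the concentration region. -/
theorem statement15 :
    ∃ C₀ : ℝ, 0 < C₀ ∧
      ∀ (a ε : ℝ) (N : ℕ), 1/2 < a → ε ∈ Set.Ioo (0:ℝ) 1 →
        C₀ * (1 + a) ≤ Real.log N →
        ∀ (t : ℝ) (x : Plane), 0 ≤ t → t ≤ ε / (2 * N) → ‖x‖ ≤ ε / (2 * N) →
          Real.sqrt (Real.log N / (2 * π)) -
              C₀ * (1 + a + ε ^ 2) / Real.sqrt (Real.log N) ≤ vKG a N t x := by
  refine ⟨1, one_pos, fun a ε N ha _ hN t x ht htε hx => ?_⟩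
  rw [one_mul] at hN ⊢
  have hlog : 0 < Real.log N := by linarith
  have hNpos : (0 : ℝ) < N := by
    rcases Nat.eq_zero_or_pos N with rfl | h
    · simp at hlog
    · exact_mod_cast h
  set L := Real.log N with hL
  set R := Real.exp (-a) * N with hRdef
  have hRpos : 0 < R := by positivity
  have hlogR : Real.log R = L - a := by
    rw [hRdef, Real.log_mul (Real.exp_pos _).ne' hNpos.ne', Real.log_exp]
    ring
  have hR : 1 < R := (Real.log_pos_iff hRpos.le).mp (by linarith)
  have hRN : R ≤ N := mul_le_of_le_one_left hNpos.le (Real.exp_le_one_iff.mpr (by linarith))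
  set δ := ε / (2 * N) with hδ
  have hδN : δ * N = ε / 2 := by
    rw [hδ]
    field_simp
  have hzpow : ∀ ξ : Plane, 1 < ‖ξ‖ → 0 < ‖ξ‖ ^ (-2 : ℤ) ∧ ‖ξ‖ ^ (-2 : ℤ) ≤ 1 :=
    fun ξ hξ => ⟨by positivity, zpow_le_one_of_nonpos₀ hξ.le (by norm_num)⟩
  have hmeas : MeasurableSet (freqSet a N) :=
    (measurableSet_lt measurable_const measurable_norm).inter
      (measurableSet_lt measurable_norm measurable_const)
  have hzpow_meas : Measurable fun ξ : Plane => ‖ξ‖ ^ (-2 : ℤ) := by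
    simp only [zpow_neg]
    exact (measurable_norm.pow_const 2).inv
  have hintegral : 2 * π * (L - a - 9 / 2 * δ ^ 2 * (R ^ 2 - 1) / 2) ≤
      ∫ ξ in freqSet a N, ‖ξ‖ ^ (-2 : ℤ) *
        Real.cos (-t * Real.sqrt (1 + ‖ξ‖ ^ 2) + ⟪ξ, x⟫) := by
    rw [← hlogR, ← setIntegral_annulus_norm_zpow_sub hR]
    refine setIntegral_mono_on ?_ ?_ hmeas fun ξ hξ => ?_
    · refine integrableOn_annulus_of_bounded R (1 + 9 / 2 * δ ^ 2)
        (hzpow_meas.sub_const _) fun ξ hξ _ => ?_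
      have := hzpow ξ hξ
      rw [abs_le]
      constructor <;> nlinarith [sq_nonneg δ]
    · refine integrableOn_annulus_of_bounded R 1
        (hzpow_meas.mul (Real.measurable_cos.comp (by fun_prop))) fun ξ hξ _ => ?_
      have := hzpow ξ hξ
      rw [abs_mul, abs_of_pos this.1]
      exact mul_le_one₀ this.2 (abs_nonneg _) (Real.abs_cos_le_one _)
    · have hpos := (hzpow ξ hξ.1).1
      have hcancel : ‖ξ‖ ^ (-2 : ℤ) * ‖ξ‖ ^ 2 = 1 := by
        have : ‖ξ‖ ≠ 0 := by linarith [hξ.1]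
        rw [zpow_neg]
        exact inv_mul_cancel₀ (by positivity)
      have hcos := mul_le_mul_of_nonneg_left
        (one_sub_sq_le_cos_phase ht htε hx hξ.1.le) hpos.le
      linear_combination hcos + 9 / 2 * δ ^ 2 * hcancel
  have herror : 9 / 2 * δ ^ 2 * (R ^ 2 - 1) / 2 ≤ ε ^ 2 := by
    have hRN2 : R ^ 2 - 1 ≤ N ^ 2 := by nlinarith
    have hδN2 : δ ^ 2 * N ^ 2 = ε ^ 2 / 4 := by
      rw [← mul_pow, hδN]
      ring
    nlinarith [mul_le_mul_of_nonneg_left hRN2 (sq_nonneg δ), sq_nonneg ε]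
  have hpi : 0 < 2 * π := by positivity
  have hsL : 0 < Real.sqrt L := Real.sqrt_pos.mpr hlog
  have hsp : 1 ≤ Real.sqrt (2 * π) := Real.one_le_sqrt.mpr (by linarith [pi_gt_three])
  have hsL2 : Real.sqrt L ^ 2 = L := Real.sq_sqrt hlog.le
  have hsp2 : Real.sqrt (2 * π) ^ 2 = 2 * π := Real.sq_sqrt hpi.le
  have hlower : 2 * π * (L - (1 + a + ε ^ 2)) ≤
      ∫ ξ in freqSet a N, ‖ξ‖ ^ (-2 : ℤ) *
        Real.cos (-t * Real.sqrt (1 + ‖ξ‖ ^ 2) + ⟪ξ, x⟫) :=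
    le_trans (mul_le_mul_of_nonneg_left (by linarith) hpi.le) hintegral
  have hscaled := mul_le_mul_of_nonneg_left hlower
    (by positivity : 0 ≤ Real.sqrt (2 * π / L) * (2 * π) ^ (-2 : ℤ))
  refine le_trans ?_ hscaled
  have hvalue : Real.sqrt (2 * π / L) * (2 * π) ^ (-2 : ℤ) *
      (2 * π * (L - (1 + a + ε ^ 2))) =
      Real.sqrt (L / (2 * π)) - (1 + a + ε ^ 2) / (Real.sqrt L * Real.sqrt (2 * π)) := by
    rw [Real.sqrt_div hpi.le, Real.sqrt_div hlog.le, zpow_neg]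
    norm_cast
    generalize Real.sqrt (2 * π) = p at *
    generalize Real.sqrt L = q at *
    rw [← hsp2, ← hsL2]
    have : p ≠ 0 := by linarith
    field_simp
  rw [hvalue]
  gcongr
  exact le_mul_of_one_le_right hsL.le hsp
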